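/- arXiv:math/0506266 — 2 statements merged into one kernel-verified Lean document; each statement's English description precedes it below -/
import Mathlib

section
/- For a Hermitian positive definite Toeplitz matrix M^N with normalized forward prediction polynomial p^N (satisfying M^N p^N = ρ e_0, p^N_0 = 1, ρ > 0), the maximum-entropy extension to a doubly-infinite Toeplitz matrix M^∞ (obtained by setting all higher reflection coefficients to zero) has inverse given by ρ^{-1} P Pᴴ, where P is the lower-triangular doubly-infinite Toeplitz matrix with symbol p(e^{iw}) = Σ_{k=0}^{N−1} p^N_k e^{ikw}. Equivalently, the spectral density of M^∞ is ρ / |Σ_{k=0}^{N−1} p^N_k e^{iwk}|², i.e. M^∞(l) = (2π)^{-1} ∫_0^{2π} ρ |p(e^{iw})|^{-2} e^{-ilw} dw for all l ∈ ℤ, and this extension agrees with M^N: M^∞(l) = M^N(l) for |l| ≤ N−1. -/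
open scoped ComplexOrder

/-- The predictor coefficients viewed as a finitely supported sequence on `ℤ`
(the symbol of the lower-triangular Toeplitz matrix `P`). -/
noncomputable def pfun (N : ℕ) (p : Fin N → ℂ) (m : ℤ) : ℂ :=
  if h : 0 ≤ m ∧ m < N then p ⟨m.toNat, by omega⟩ else 0

open Polynomial Finset

theorem aux_nozero (n : ℕ) (M : ℤ → ℂ) (hherm : ∀ l : ℤ, M (-l) = star (M l))
    (hpsd : ∀ u : ℕ → ℂ, 0 ≤ (∑ k ∈ range (n+1), ∑ l ∈ range (n+1),
      star (u k) * (M ((k : ℤ) - (l : ℤ)) * u l)).re)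
    (Q : ℂ[X]) (hdeg : Q.natDegree ≤ n) (hQ0 : Q.coeff 0 = 1) (ρ : ℝ) (hρ : 0 < ρ)
    (hQ : ∀ k ∈ range (n+1), ∑ l ∈ range (n+1), M ((k : ℤ) - (l : ℤ)) * Q.coeff l =
      if k = 0 then (ρ : ℂ) else 0) (z : ℂ) (hz : ‖z‖ ≤ 1) : Q.eval z ≠ 0 := by
  intro h0
  obtain ⟨q, hq⟩ := dvd_iff_isRoot.mpr h0
  have hQne : Q ≠ 0 := by rintro rfl; simp at hQ0
  have hqne : q ≠ 0 := by rintro rfl; simp at hq; exact hQne hq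
  have hqd : q.coeff n = 0 := by
    apply coeff_eq_zero_of_natDegree_lt
    have := congrArg natDegree hq
    rw [natDegree_mul (X_sub_C_ne_zero z) hqne, natDegree_X_sub_C] at this
    omega
  set u : ℕ → ℂ := fun k => q.coeff k with hu
  set v : ℕ → ℂ := fun k => (X * q).coeff k with hv
  have hv0 : v 0 = 0 := by simp [hv]
  have hvs : ∀ k, v (k+1) = u k := by intro k; simp [hv, hu]
  have hp : ∀ k, z * u k = v k - Q.coeff k := by
    intro k; rw [hq]; simp [hv, hu, sub_mul]
  let B : (ℕ → ℂ) → (ℕ → ℂ) → ℂ := fun a b => ∑ k ∈ range (n+1), ∑ l ∈ range (n+1),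
      star (a k) * (M ((k : ℤ) - (l : ℤ)) * b l)
  have hBh : ∀ a b, star (B a b) = B b a := by
    intro a b
    simp only [B, star_sum]
    rw [sum_comm]
    refine sum_congr rfl fun k _ => sum_congr rfl fun l _ => ?_
    have := hherm ((l : ℤ) - k)
    rw [neg_sub] at this
    rw [this]; simp only [star_mul', star_star]; ring
  have hBp : ∀ a : ℕ → ℂ, B a Q.coeff = star (a 0) * ρ := by
    intro a
    simp only [B, ← mul_sum]
    rw [sum_congr rfl fun k hk => by rw [hQ k hk]]
    simp
  have h1 : B v v = B u u := by
    simp only [B]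
    refine Eq.trans (sum_range_succ' _ _) (Eq.trans ?_ (sum_range_succ _ _).symm)
    simp only [hv0]
    have : u n = 0 := hqd
    simp only [this, star_zero, zero_mul, sum_const_zero, add_zero]
    refine sum_congr rfl fun k _ => ?_
    refine Eq.trans (sum_range_succ' _ _) (Eq.trans ?_ (sum_range_succ _ _).symm)
    simp only [hv0, this, mul_zero, add_zero, hvs]
    refine sum_congr rfl fun l _ => ?_
    push_cast
    rw [add_sub_add_right_eq_sub]
  have h2 : B v Q.coeff = 0 := by rw [hBp, hv0]; simp
  have h3 : B Q.coeff v = 0 := by rw [← hBh, h2]; simp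
  have h4 : B Q.coeff Q.coeff = ρ := by rw [hBp, hQ0]; simp
  have h5 : star z * z * B u u = B v v - B v Q.coeff - B Q.coeff v + B Q.coeff Q.coeff := by
    simp only [B, mul_sum, ← sum_sub_distrib, ← sum_add_distrib]
    refine sum_congr rfl fun k _ => sum_congr rfl fun l _ => ?_
    have a1 := congrArg star (hp k)
    have a2 := hp l
    simp only [star_mul', star_sub] at a1
    linear_combination (star z * star (u k) * M (k - l)) * a2 + (v l - Q.coeff l) * M (k-l) * a1
  rw [h1, h2, h3, h4] at h5
  have h6 : star z * z = ((‖z‖^2 : ℝ) : ℂ) := by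
    rw [mul_comm]; simpa using Complex.mul_conj' z
  rw [h6] at h5
  have h7 := congrArg Complex.re h5
  rw [Complex.re_ofReal_mul] at h7
  simp at h7
  have h8 : 0 ≤ (B u u).re := hpsd u
  have h9 : ‖z‖^2 ≤ 1 := by nlinarith [norm_nonneg z]
  nlinarith


theorem aux_split (n : ℕ) (H : ℂ[X]) (h : ∀ i, n ≤ i → i ≤ 2*n → H.coeff i = 0) :
    ∃ A B : ℂ[X], H = A + X^(2*n+1) * B ∧ A.degree < n ∧ (A = 0 → ∀ i, i < n → H.coeff i = 0) := by
  have hc : ∀ i, (∑ j ∈ range n, monomial j (H.coeff j)).coeff i = if i < n then H.coeff i else 0 := by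
    intro i; simp [coeff_monomial]
  have : X^(2*n+1) ∣ H - ∑ j ∈ range n, monomial j (H.coeff j) := by
    rw [X_pow_dvd_iff]
    intro d hd
    rw [coeff_sub, hc]
    split_ifs with h1
    · simp
    · rw [h d (by omega) (by omega)]; simp
  obtain ⟨B, hB⟩ := this
  refine ⟨∑ j ∈ range n, monomial j (H.coeff j), B, by rw [← hB]; ring, ?_, ?_⟩
  · rw [degree_lt_iff_coeff_zero]
    intro m hm
    rw [hc, if_neg (by omega)]
  · intro h0 i hi
    have := hc i
    rw [h0, if_pos hi] at this
    simpa using this.symm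

theorem aux_uniq (n : ℕ) (D : ℤ → ℂ) (hherm : ∀ l : ℤ, D (-l) = star (D l))
    (Q : ℂ[X]) (hdeg : Q.natDegree ≤ n) (hQ0 : Q.coeff 0 = 1)
    (hnz : ∀ z : ℂ, ‖z‖ ≤ 1 → Q.eval z ≠ 0)
    (hQ : ∀ k ∈ range (n+1), ∑ l ∈ range (n+1), D ((k : ℤ) - (l : ℤ)) * Q.coeff l = 0)
    (l : ℤ) (hl : |l| ≤ n) : D l = 0 := by
  have hQne : Q ≠ 0 := by rintro rfl; simp at hQ0
  set E : ℂ[X] := ∑ j ∈ range (2*n+1), monomial j (D ((j : ℤ) - n)) with hE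
  have hEc : ∀ i, E.coeff i = if i < 2*n+1 then D ((i : ℤ) - n) else 0 := by
    intro i; simp [hE, coeff_monomial]
  have hEd : E.natDegree ≤ 2*n := by
    rw [natDegree_le_iff_coeff_eq_zero]
    intro m hm
    rw [hEc, if_neg (by omega)]
  suffices hE0 : E = 0 by
    have h := hEc (l + n).toNat
    rw [abs_le] at hl
    rw [hE0, if_pos (by omega), Int.toNat_of_nonneg (by omega)] at h
    simpa using h.symm
  let c : ℂ →+* ℂ := starRingEnd ℂ
  set Qs := reflect n (Q.map c) with hQs
  have hQsc : ∀ i, i ≤ n → Qs.coeff i = star (Q.coeff (n - i)) := by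
    intro i hi; rw [hQs, coeff_reflect, revAt_le hi, coeff_map]; rfl
  have hQsd : Qs.natDegree ≤ n := by
    rw [natDegree_le_iff_coeff_eq_zero]
    intro m hm
    rw [hQs, coeff_reflect, revAt_eq_self_of_lt hm, coeff_map, coeff_eq_zero_of_natDegree_lt (by omega)]
    simp
  have hQsn : Qs.coeff n = 1 := by rw [hQsc n le_rfl]; simp [hQ0]
  have hQsne : Qs ≠ 0 := by intro h; rw [h] at hQsn; simp at hQsn
  have hEs : reflect (2*n) (E.map c) = E := by
    ext i
    rw [coeff_reflect, coeff_map]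
    by_cases hi : i ≤ 2*n
    · rw [revAt_le hi, hEc, hEc, if_pos (by omega), if_pos (by omega)]
      have h1 : ((2*n - i : ℕ) : ℤ) - n = -((i:ℤ) - n) := by push_cast [Nat.cast_sub hi]; ring
      rw [h1, hherm]
      exact star_star _
    · rw [revAt_eq_self_of_lt (by omega), hEc, if_neg (by omega)]; simp
  set H := E * Q with hH
  have hHd : H.natDegree ≤ 2*n + n := natDegree_mul_le_of_le hEd hdeg
  have hHs : reflect (2*n+n) (H.map c) = E * Qs := by
    rw [hH, Polynomial.map_mul, reflect_mul _ _ (natDegree_map_le.trans hEd) (natDegree_map_le.trans hdeg), hEs]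
  have hHc : ∀ i, n ≤ i → i ≤ 2*n → H.coeff i = 0 := by
    intro i h1 h2
    obtain ⟨k, rfl⟩ := Nat.exists_eq_add_of_le h1
    rw [hH, mul_comm, coeff_mul, Nat.sum_antidiagonal_eq_sum_range_succ (fun a b => Q.coeff a * E.coeff b)]
    rw [← hQ k (mem_range.2 (by omega))]
    rw [← sum_subset (s₁ := range (n+1))]
    · refine sum_congr rfl fun l hl => ?_
      rw [mem_range] at hl
      rw [hEc, if_pos (by omega), mul_comm, Nat.cast_sub (by omega)]
      congr 2
      push_cast; ring
    · intro x hx; rw [mem_range] at *; omega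
    · intro x _ hx
      rw [mem_range] at hx
      rw [coeff_eq_zero_of_natDegree_lt (by omega), zero_mul]
  have hHsc : ∀ i, n ≤ i → i ≤ 2*n → (E * Qs).coeff i = 0 := by
    intro i h1 h2
    rw [← hHs, coeff_reflect, revAt_le (by omega), coeff_map, hHc _ (by omega) (by omega)]
    simp
  obtain ⟨A, B, hAB, hA, hA0⟩ := aux_split n H hHc
  obtain ⟨A2, B2, hAB2, hA2, hA20⟩ := aux_split n _ hHsc
  have hQd' : Q.degree ≤ n := natDegree_le_iff_degree_le.1 hdeg
  have hQsd' : Qs.degree ≤ n := natDegree_le_iff_degree_le.1 hQsd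
  have key : A * Qs = A2 * Q := by
    have h1 : X^(2*n+1) ∣ A * Qs - A2 * Q := by
      refine ⟨B2 * Q - B * Qs, ?_⟩
      have : H * Qs = E * Qs * Q := by rw [hH]; ring
      rw [hAB2, hAB] at this
      linear_combination this
    have h2 := eq_zero_of_dvd_of_natDegree_lt h1 ?_
    · exact sub_eq_zero.1 h2
    rw [natDegree_X_pow]
    have hAd : A.natDegree ≤ n := natDegree_le_iff_degree_le.2 hA.le
    have hA2d : A2.natDegree ≤ n := natDegree_le_iff_degree_le.2 hA2.le
    have := natDegree_sub_le_of_le (natDegree_mul_le_of_le hAd hQsd) (natDegree_mul_le_of_le hA2d hdeg)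
    rw [max_self] at this
    omega
  have hcop : IsCoprime Qs Q := by
    refine (isCoprime_iff_aeval_ne_zero_of_isAlgClosed ℂ ℂ _ _).2 ?_
    intro a
    by_contra! hcon
    obtain ⟨h1, h2⟩ := hcon
    rw [coe_aeval_eq_eval] at h1 h2
    have ha : 1 < ‖a‖ := by
      by_contra hh
      exact hnz a (not_lt.1 hh) h2
    have ha0 : a ≠ 0 := by rintro rfl; simp at ha; linarith
    let _ : Invertible a⁻¹ := invertibleOfNonzero (inv_ne_zero ha0)
    have h3 := (eval₂_reflect_eq_zero_iff (RingHom.id ℂ) a⁻¹ n (Q.map c) (natDegree_map_le.trans hdeg)).1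
    rw [invOf_eq_inv, inv_inv, ← eval, ← eval] at h3
    have h4 := h3 h1
    have h5 : (Q.map c).eval (c (star a⁻¹)) = c (Q.eval (star a⁻¹)) := by
      rw [eval_map, eval₂_hom]
    have h6 : c (star a⁻¹) = a⁻¹ := star_star _
    rw [h6, h4] at h5
    have h7 : Q.eval (star a⁻¹) = 0 := (map_eq_zero c).1 h5.symm
    refine hnz _ ?_ h7
    rw [norm_star, norm_inv]
    exact inv_le_one_of_one_le₀ ha.le
  have hA2z : A2 = 0 := by
    have : Qs ∣ A2 := hcop.dvd_of_dvd_mul_right ⟨A, by rw [← key]; ring⟩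
    refine eq_zero_of_dvd_of_degree_lt this (hA2.trans_le ?_)
    exact le_degree_of_ne_zero (by rw [hQsn]; simp)
  have hAz : A = 0 := by
    rw [hA2z, zero_mul] at key
    exact (mul_eq_zero.1 key).resolve_right hQsne
  have hHz : H = 0 := by
    ext i
    rw [coeff_zero]
    by_cases h1 : i < n
    · exact hA0 hAz i h1
    by_cases h2 : i ≤ 2*n
    · exact hHc i (by omega) h2
    by_cases h3 : i ≤ 2*n+n
    · have := hA20 hA2z (2*n+n-i) (by omega)
      rw [← hHs, coeff_reflect, revAt_le (by omega), coeff_map, map_eq_zero] at this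
      rwa [show 2*n+n-(2*n+n-i) = i by omega] at this
    · exact coeff_eq_zero_of_natDegree_lt (by omega)
  exact (mul_eq_zero.1 hHz).resolve_right hQne


theorem aux_lin {ι : Type*} (s : Finset ι) (F : ℝ → ℂ) (hF : Continuous F) (κ : ℂ) (c : ι → ℂ)
    (m : ι → ℤ) :
    ∑ j ∈ s, (κ * ∫ w in (0:ℝ)..(2*Real.pi), F w * Complex.exp (-Complex.I * (m j : ℂ) * (w:ℂ))) * c j =
    κ * ∫ w in (0:ℝ)..(2*Real.pi), F w * ∑ j ∈ s, c j * Complex.exp (-Complex.I * (m j : ℂ) * (w:ℂ)) := by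
  simp only [mul_sum]
  rw [intervalIntegral.integral_finsetSum]
  · rw [mul_sum]
    refine sum_congr rfl fun j _ => ?_
    rw [mul_assoc, ← intervalIntegral.integral_mul_const]
    congr 2
    ext w; ring
  · intro j _
    apply Continuous.intervalIntegrable
    fun_prop

theorem aux_eval (Q : ℂ[X]) (n : ℕ) (hdeg : Q.natDegree ≤ n) (k : ℤ) (w : ℝ) :
    ∑ l ∈ range (n+1), Q.coeff l * Complex.exp (-Complex.I * ((k - l : ℤ) : ℂ) * (w:ℂ)) =
    Complex.exp (-Complex.I * (k : ℂ) * (w:ℂ)) * Q.eval (Complex.exp (Complex.I * w)) := by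
  rw [eval_eq_sum_range' (n := n+1) (by omega), mul_sum]
  refine sum_congr rfl fun l _ => ?_
  rw [← Complex.exp_nat_mul, mul_left_comm, ← Complex.exp_add]
  congr 2
  push_cast; ring

theorem aux_cont (Q : ℂ[X]) (hnz : ∀ z : ℂ, ‖z‖ ≤ 1 → Q.eval z ≠ 0) (ρ : ℝ) :
    Continuous fun w : ℝ => ((ρ / ‖Q.eval (Complex.exp (Complex.I * (w:ℂ)))‖ ^ 2 : ℝ) : ℂ) := by
  have hc : Continuous fun w : ℝ => Q.eval (Complex.exp (Complex.I * (w:ℂ))) :=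
    Q.continuous.comp (by fun_prop)
  refine Complex.continuous_ofReal.comp (continuous_const.div (by fun_prop) ?_)
  intro w
  have : Q.eval (Complex.exp (Complex.I * (w:ℂ))) ≠ 0 := hnz _ (by
    rw [mul_comm, Complex.norm_exp_ofReal_mul_I])
  positivity

theorem aux_C2 (n : ℕ) (Q : ℂ[X]) (hdeg : Q.natDegree ≤ n) (hQ0 : Q.coeff 0 = 1)
    (hnz : ∀ z : ℂ, ‖z‖ ≤ 1 → Q.eval z ≠ 0) (ρ : ℝ) (Minf : ℤ → ℂ)
    (hM : ∀ l : ℤ, Minf l = (1 / (2 * Real.pi) : ℂ) *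
      ∫ w in (0 : ℝ)..(2 * Real.pi),
        ((ρ / ‖Q.eval (Complex.exp (Complex.I * (w:ℂ)))‖ ^ 2 : ℝ) : ℂ) *
          Complex.exp (-Complex.I * (l : ℂ) * (w : ℂ))) (k : ℕ) :
    ∑ l ∈ range (n+1), Minf ((k:ℤ) - (l:ℤ)) * Q.coeff l = if k = 0 then (ρ : ℂ) else 0 := by
  simp only [hM]
  rw [aux_lin _ _ (aux_cont Q hnz ρ) _ _ (fun l : ℕ => (k:ℤ) - (l:ℤ))]
  simp only [aux_eval Q n hdeg]
  have hmv : Real.circleAverage (fun z : ℂ => z^k / Q.eval z) 0 1 = 0^k / Q.eval 0 := by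
    apply DiffContOnCl.circleAverage (f := fun z : ℂ => z^k / Q.eval z)
    apply DifferentiableOn.diffContOnCl
    intro z hz
    have hz' : ‖z‖ ≤ 1 := by
      have := Metric.closure_ball_subset_closedBall hz
      simpa using this
    apply DifferentiableAt.differentiableWithinAt
    exact (differentiableAt_id.pow k).div Q.differentiableAt (hnz z hz')
  have hpt : ∀ w : ℝ, ((ρ / ‖Q.eval (Complex.exp (Complex.I * (w:ℂ)))‖ ^ 2 : ℝ) : ℂ) *
      (Complex.exp (-Complex.I * ((k:ℤ) : ℂ) * (w : ℂ)) * Q.eval (Complex.exp (Complex.I * (w:ℂ))))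
      = ρ * (starRingEnd ℂ) ((fun z : ℂ => z^k / Q.eval z) (circleMap 0 1 w)) := by
    intro w
    have hcm : circleMap 0 1 w = Complex.exp (Complex.I * w) := by simp [circleMap, mul_comm]
    rw [hcm]
    have hne : Q.eval (Complex.exp (Complex.I * (w:ℂ))) ≠ 0 := hnz _ (by
      rw [mul_comm, Complex.norm_exp_ofReal_mul_I])
    set a := Q.eval (Complex.exp (Complex.I * (w:ℂ))) with ha
    have hca : (starRingEnd ℂ) a ≠ 0 := (_root_.map_ne_zero _).2 hne
    simp only [map_div₀, map_pow, ← ha]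
    push_cast
    rw [← Complex.mul_conj', ← Complex.exp_conj, ← Complex.exp_nat_mul]
    have : (k:ℂ) * (starRingEnd ℂ) (Complex.I * w) = -Complex.I * (k:ℂ) * w := by
      simp; ring
    rw [this]
    field_simp
  rw [show (∫ w in (0:ℝ)..(2*Real.pi), ((ρ / ‖Q.eval (Complex.exp (Complex.I * (w:ℂ)))‖ ^ 2 : ℝ) : ℂ) *
      (Complex.exp (-Complex.I * ((k:ℤ) : ℂ) * (w : ℂ)) * Q.eval (Complex.exp (Complex.I * (w:ℂ))))) =
      ∫ w in (0:ℝ)..(2*Real.pi), ρ * (starRingEnd ℂ) ((fun z : ℂ => z^k / Q.eval z) (circleMap 0 1 w))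
      from intervalIntegral.integral_congr fun w _ => hpt w]
  rw [intervalIntegral.integral_const_mul]
  have hconj : (∫ w in (0:ℝ)..(2*Real.pi), (starRingEnd ℂ) ((fun z : ℂ => z^k / Q.eval z) (circleMap 0 1 w)))
      = (starRingEnd ℂ) (∫ w in (0:ℝ)..(2*Real.pi), (fun z : ℂ => z^k / Q.eval z) (circleMap 0 1 w)) := by
    simp only [intervalIntegral.integral_of_le Real.two_pi_pos.le]
    exact integral_conj
  rw [hconj]
  have h2 := congrArg (starRingEnd ℂ) hmv
  rw [Real.circleAverage_def, Complex.real_smul, map_mul, Complex.conj_ofReal,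
    ← coeff_zero_eq_eval_zero, hQ0, div_one] at h2
  push_cast at h2
  rw [mul_left_comm, one_div, h2]
  by_cases hk : k = 0 <;> simp [hk]

theorem aux_C3 (n : ℕ) (Q : ℂ[X]) (hdeg : Q.natDegree ≤ n)
    (hnz : ∀ z : ℂ, ‖z‖ ≤ 1 → Q.eval z ≠ 0) (ρ : ℝ) (Minf : ℤ → ℂ)
    (hM : ∀ l : ℤ, Minf l = (1 / (2 * Real.pi) : ℂ) *
      ∫ w in (0 : ℝ)..(2 * Real.pi),
        ((ρ / ‖Q.eval (Complex.exp (Complex.I * (w:ℂ)))‖ ^ 2 : ℝ) : ℂ) *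
          Complex.exp (-Complex.I * (l : ℂ) * (w : ℂ))) (k : ℤ) :
    ∑ s ∈ range (n+1), ∑ l ∈ range (n+1), Minf (k + (s:ℤ) - (l:ℤ)) * (Q.coeff l * star (Q.coeff s))
      = if k = 0 then (ρ : ℂ) else 0 := by
  simp only [hM]
  rw [← sum_product', aux_lin _ _ (aux_cont Q hnz ρ) _ _ (fun x : ℕ × ℕ => k + (x.1:ℤ) - (x.2:ℤ))]
  have hpt : ∀ w : ℝ, ((ρ / ‖Q.eval (Complex.exp (Complex.I * (w:ℂ)))‖ ^ 2 : ℝ) : ℂ) *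
      (∑ j ∈ range (n+1) ×ˢ range (n+1), Q.coeff j.2 * star (Q.coeff j.1) *
        Complex.exp (-Complex.I * ((k + (j.1:ℤ) - (j.2:ℤ) : ℤ) : ℂ) * (w : ℂ)))
      = ρ * Complex.exp ((-Complex.I * (k:ℂ)) * w) := by
    intro w
    have hne : Q.eval (Complex.exp (Complex.I * (w:ℂ))) ≠ 0 := hnz _ (by
      rw [mul_comm, Complex.norm_exp_ofReal_mul_I])
    have h1 : (∑ j ∈ range (n+1) ×ˢ range (n+1), Q.coeff j.2 * star (Q.coeff j.1) *
        Complex.exp (-Complex.I * ((k + (j.1:ℤ) - (j.2:ℤ) : ℤ) : ℂ) * (w : ℂ))) =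
        Complex.exp ((-Complex.I * (k:ℂ)) * w) * (Q.eval (Complex.exp (Complex.I * (w:ℂ))) *
         (starRingEnd ℂ) (Q.eval (Complex.exp (Complex.I * (w:ℂ))))) := by
      rw [sum_product]
      have h2 : (starRingEnd ℂ) (Q.eval (Complex.exp (Complex.I * (w:ℂ)))) =
          ∑ s ∈ range (n+1), star (Q.coeff s) * Complex.exp (-Complex.I * (s:ℂ) * w) := by
        rw [eval_eq_sum_range' (n := n+1) (by omega), map_sum]
        refine sum_congr rfl fun s _ => ?_
        rw [map_mul, map_pow, ← Complex.exp_conj, ← Complex.exp_nat_mul]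
        have : (s:ℂ) * (starRingEnd ℂ) (Complex.I * w) = -Complex.I * (s:ℂ) * w := by
          simp; ring
        rw [this]; rfl
      rw [h2, mul_sum, mul_sum]
      refine sum_congr rfl fun s _ => ?_
      have h3 := aux_eval Q n hdeg (k + s) w
      calc _ = star (Q.coeff s) * ∑ l ∈ range (n+1), Q.coeff l *
            Complex.exp (-Complex.I * ((k + s - l : ℤ) : ℂ) * (w:ℂ)) := by
            rw [mul_sum]; refine sum_congr rfl fun l _ => by ring
        _ = _ := by
          rw [h3]
          have : -Complex.I * ((k + s : ℤ) : ℂ) * (w:ℂ) = (-Complex.I * (k:ℂ)) * w + -Complex.I * (s:ℂ) * w := by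
            push_cast; ring
          rw [this, Complex.exp_add]; ring
    rw [h1]
    set a := Q.eval (Complex.exp (Complex.I * (w:ℂ))) with ha
    have hca : (starRingEnd ℂ) a ≠ 0 := (_root_.map_ne_zero _).2 hne
    push_cast
    rw [← Complex.mul_conj']
    field_simp
  rw [intervalIntegral.integral_congr fun w _ => hpt w, intervalIntegral.integral_const_mul]
  have hpi : (Real.pi : ℂ) ≠ 0 := by exact_mod_cast Real.pi_ne_zero
  by_cases hk : k = 0
  · simp [hk]; field_simp
  · have hk' : -Complex.I * (k:ℂ) ≠ 0 := by simp [hk]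
    rw [if_neg hk, integral_exp_mul_complex hk']
    have : Complex.exp (-Complex.I * k * ((2 * Real.pi : ℝ) : ℂ)) = 1 := by
      rw [Complex.exp_eq_one_iff]
      refine ⟨-k, ?_⟩
      push_cast; ring
    rw [this]; simp


theorem aux_fs (n : ℕ) (p : Fin (n+1) → ℂ) (Q : ℂ[X]) (hdeg : Q.natDegree ≤ n)
    (hc : ∀ k : Fin (n+1), Q.coeff k = p k) (m : ℤ) :
    pfun (n+1) p m = if 0 ≤ m then Q.coeff m.toNat else 0 := by
  unfold pfun
  split_ifs with h1 h2 h2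
  · rw [← hc]
  · omega
  · rw [coeff_eq_zero_of_natDegree_lt]; push_cast at h1; omega
  · rfl

theorem aux_supp (n : ℕ) (p : Fin (n+1) → ℂ) (m : ℤ) (h : pfun (n+1) p m ≠ 0) :
    0 ≤ m ∧ m ≤ n := by
  unfold pfun at h
  split_ifs at h with h1
  · push_cast at h1; omega
  · exact absurd rfl h

theorem aux_finsum (n : ℕ) (f : ℤ → ℂ) (a : ℤ) (hf : ∀ m, f m ≠ 0 → a ≤ m ∧ m ≤ a + n) :
    ∑ᶠ m, f m = ∑ j ∈ range (n+1), f (a + j) := by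
  rw [finsum_eq_sum_of_support_subset (s := (range (n+1)).image (fun j : ℕ => a + (j:ℤ)))]
  · rw [sum_image]
    intro x _ y _ h
    simpa using h
  · intro m hm
    obtain ⟨h1, h2⟩ := hf m hm
    simp only [coe_image, Set.mem_image, coe_range, Set.mem_Iio]
    exact ⟨(m - a).toNat, by omega, by omega⟩

theorem stmt11 (N : ℕ) (hN : 0 < N) (M : ℤ → ℂ)
    (hherm : ∀ l : ℤ, M (-l) = star (M l))
    (hpos : (Matrix.of fun k l : Fin N => M ((k : ℤ) - (l : ℤ))).PosDef)
    (p : Fin N → ℂ) (ρ : ℝ) (hρ : 0 < ρ)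
    (hp : (Matrix.of fun k l : Fin N => M ((k : ℤ) - (l : ℤ))).mulVec p =
      (ρ : ℂ) • (Pi.single ⟨0, hN⟩ 1 : Fin N → ℂ))
    (hp0 : p ⟨0, hN⟩ = 1)
    (Minf : ℤ → ℂ)
    (hMinf : ∀ l : ℤ, Minf l = (1 / (2 * Real.pi) : ℂ) *
      ∫ w in (0 : ℝ)..(2 * Real.pi),
        ((ρ / ‖∑ k : Fin N, p k * Complex.exp (Complex.I * (w : ℂ) * (k : ℂ))‖ ^ 2 : ℝ) : ℂ) *
          Complex.exp (-Complex.I * (l : ℂ) * (w : ℂ))) :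
    (∀ l : ℤ, |l| ≤ (N : ℤ) - 1 → Minf l = M l) ∧
    (∀ k l : ℤ,
      (∑ᶠ m : ℤ, Minf (k - m) *
          ((ρ : ℂ)⁻¹ * ∑ᶠ r : ℤ, pfun N p (m - r) * star (pfun N p (l - r)))) =
        if k = l then 1 else 0) := by
  obtain ⟨n, rfl⟩ : ∃ n, N = n + 1 := ⟨N - 1, by omega⟩
  set Q : ℂ[X] := ∑ k : Fin (n+1), monomial (k : ℕ) (p k) with hQdef
  have hc : ∀ k : Fin (n+1), Q.coeff k = p k := by
    intro k
    simp [hQdef, coeff_monomial, Fin.val_inj]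
  have hdeg : Q.natDegree ≤ n := by
    apply natDegree_sum_le_of_forall_le
    intro k _
    exact (natDegree_monomial_le _).trans (by omega)
  have hQ0 : Q.coeff 0 = 1 := by rw [← hp0, ← hc]
  have hQ : ∀ k ∈ range (n+1), ∑ l ∈ range (n+1), M ((k : ℤ) - (l : ℤ)) * Q.coeff l =
      if k = 0 then (ρ : ℂ) else 0 := by
    intro k hk
    have := congrFun hp ⟨k, mem_range.1 hk⟩
    rw [sum_range]
    simp only [Matrix.mulVec, dotProduct, Matrix.of_apply] at this
    simp only [hc, this]
    simp [Pi.single_apply]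
  have hpsd : ∀ u : ℕ → ℂ, 0 ≤ (∑ k ∈ range (n+1), ∑ l ∈ range (n+1),
      star (u k) * (M ((k : ℤ) - (l : ℤ)) * u l)).re := by
    intro u
    have := hpos.posSemidef.dotProduct_mulVec_nonneg (fun k : Fin (n+1) => u k)
    have h2 := (Complex.le_def.1 this).1
    simp only [Matrix.mulVec, dotProduct, Matrix.of_apply, mul_sum, Pi.star_apply] at h2
    simpa only [sum_range, Complex.zero_re] using h2
  have hnz := aux_nozero n M hherm hpsd Q hdeg hQ0 ρ hρ hQ
  have heval : ∀ w : ℝ, ∑ k : Fin (n+1), p k * Complex.exp (Complex.I * (w : ℂ) * (k : ℂ)) =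
      Q.eval (Complex.exp (Complex.I * (w:ℂ))) := by
    intro w
    rw [hQdef, eval_finsetSum]
    refine sum_congr rfl fun k _ => ?_
    rw [eval_monomial, ← Complex.exp_nat_mul]
    congr 2; ring
  simp only [heval] at hMinf
  have hMh : ∀ l : ℤ, Minf (-l) = star (Minf l) := by
    intro l
    rw [hMinf, hMinf, Complex.star_def, map_mul]
    simp only [intervalIntegral.integral_of_le Real.two_pi_pos.le]
    rw [← integral_conj]
    congr 1
    · simp [Complex.conj_ofNat]
    · congr 1
      ext w
      rw [map_mul, Complex.conj_ofReal, ← Complex.exp_conj]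
      congr 2
      simp
  refine ⟨?_, ?_⟩
  · intro l hl
    have := aux_uniq n (fun l => Minf l - M l) (by intro l; simp [hMh, hherm]) Q hdeg hQ0 hnz
      (by
        intro k hk
        simp only [sub_mul, sum_sub_distrib]
        rw [hQ k hk, aux_C2 n Q hdeg hQ0 hnz ρ Minf hMinf k, sub_self]) l
      (by push_cast at hl; linarith)
    exact sub_eq_zero.1 this
  · intro k l
    have hpc := aux_fs n p Q hdeg hc
    have hsup := aux_supp n p
    have hinner : ∀ m : ℤ, ∑ᶠ r : ℤ, pfun (n+1) p (m - r) * star (pfun (n+1) p (l - r)) =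
        ∑ s ∈ range (n+1), pfun (n+1) p (m - l + s) * star (Q.coeff s) := by
      intro m
      rw [aux_finsum n _ (l - n), ← sum_range_reflect]
      · refine sum_congr rfl fun s hs => ?_
        rw [mem_range] at hs
        have e : l - (n:ℤ) + ((n + 1 - 1 - s : ℕ) : ℤ) = l - s := by omega
        rw [e]
        congr 2
        · congr 1; ring
        · rw [hpc, if_pos (by omega)]; congr 1; omega
      · intro r hr
        have := hsup _ (star_ne_zero.1 (right_ne_zero_of_mul hr))
        omega
    simp only [hinner]
    have h1 : ∀ s : ℕ, ∀ m, Minf (k - m) * ((ρ:ℂ)⁻¹ * (pfun (n+1) p (m - l + s) * star (Q.coeff s))) ≠ 0 →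
        l - s ≤ m ∧ m ≤ l - s + n := by
      intro s m hm
      have := hsup _ (left_ne_zero_of_mul (right_ne_zero_of_mul (right_ne_zero_of_mul hm)))
      omega
    simp only [mul_sum]
    rw [finsum_sum_comm]
    · have h2 : ∀ s ∈ range (n+1), ∑ᶠ m, Minf (k - m) * ((ρ:ℂ)⁻¹ * (pfun (n+1) p (m - l + s) * star (Q.coeff s)))
          = (ρ:ℂ)⁻¹ * ∑ j ∈ range (n+1), Minf ((k - l) + (s:ℤ) - (j:ℤ)) * (Q.coeff j * star (Q.coeff s)) := by
        intro s _
        rw [aux_finsum n _ (l - s) (h1 s), mul_sum]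
        refine sum_congr rfl fun j _ => ?_
        rw [hpc, if_pos (by omega), show (l - s + j - l + (s:ℤ)).toNat = j by omega,
          show k - (l - s + (j:ℤ)) = k - l + s - j by ring]
        ring
      rw [sum_congr rfl h2, ← mul_sum, aux_C3 n Q hdeg hnz ρ Minf hMinf (k - l)]
      have hρ' : (ρ:ℂ) ≠ 0 := by exact_mod_cast hρ.ne'
      by_cases hkl : k = l
      · simp [hkl, hρ']
      · rw [if_neg hkl, if_neg (by omega), mul_zero]
    · intro s _
      refine (Set.finite_Icc (l - s : ℤ) (l - s + n)).subset ?_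
      intro m hm
      exact h1 s m hm
end

section
/- Correlation matching of the 1D maximum entropy extension: with M^N positive definite Toeplitz and p^N its normalized predictor (M^N p^N = ρ e_0, p^N_0 = 1, ρ > 0), the spectral density S(w) = ρ / |Σ_{k=0}^{N−1} p^N_k e^{iwk}|² satisfies (2π)^{-1} ∫_0^{2π} S(w) e^{-ilw} dw = M(l) for every l with |l| ≤ N−1. -/
open scoped ComplexOrder
open Polynomial ComplexConjugate

lemma aux_stable (n : ℕ) (M : ℤ → ℂ) (ρ : ℝ) (hρ : 0 < ρ)
    (hherm : ∀ l : ℤ, M (-l) = conj (M l))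
    (psd : ∀ x : ℕ → ℂ, 0 ≤ (∑ i ∈ Finset.range (n+1), ∑ j ∈ Finset.range (n+1),
      conj (x i) * M ((i:ℤ) - j) * x j).re)
    (P : ℂ[X]) (hdeg : P.natDegree ≤ n)
    (h : ∀ k ∈ Finset.range (n+1), ∑ j ∈ Finset.range (n+1), M ((k:ℤ) - j) * P.coeff j
      = if k = 0 then (ρ : ℂ) else 0)
    (h0 : P.coeff 0 = 1) (z : ℂ) (hz : ‖z‖ ≤ 1) : P.eval z ≠ 0 := by
  intro hroot
  obtain ⟨Q, hQ⟩ := dvd_iff_isRoot.mpr hroot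
  have hQ0 : Q ≠ 0 := by
    rintro rfl
    rw [mul_zero] at hQ; simp [hQ] at h0
  have hPdeg : P.natDegree = 1 + Q.natDegree := by
    rw [hQ, natDegree_mul (X_sub_C_ne_zero z) hQ0, natDegree_X_sub_C]
  have hQn : Q.coeff n = 0 := coeff_eq_zero_of_natDegree_lt (by omega)
  set B : (ℕ → ℂ) → (ℕ → ℂ) → ℂ := fun x y => ∑ i ∈ Finset.range (n+1),
    ∑ j ∈ Finset.range (n+1), conj (x i) * M ((i:ℤ) - j) * y j with hB
  have hsh : B (X * Q).coeff (X * Q).coeff = B Q.coeff Q.coeff := by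
    simp only [hB]
    rw [Finset.sum_range_succ']
    conv_rhs => rw [Finset.sum_range_succ]
    simp only [coeff_X_mul_zero, coeff_X_mul, hQn, map_zero, zero_mul, Finset.sum_const_zero, add_zero]
    refine Finset.sum_congr rfl fun i _ => ?_
    rw [Finset.sum_range_succ', Finset.sum_range_succ]
    simp only [coeff_X_mul_zero, coeff_X_mul, hQn, mul_zero, add_zero]
    refine Finset.sum_congr rfl fun j _ => ?_
    congr 3
    push_cast; ring
  have hBp : ∀ x : ℕ → ℂ, B x P.coeff = ρ * conj (x 0) := by
    intro x
    simp only [hB]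
    have : ∀ i ∈ Finset.range (n+1), ∑ j ∈ Finset.range (n+1), conj (x i) * M ((i:ℤ) - j) * P.coeff j
        = if i = 0 then ρ * conj (x 0) else 0 := by
      intro i hi
      simp only [mul_assoc]
      rw [← Finset.mul_sum, h i hi]
      split_ifs with h1
      · subst h1; ring
      · simp
    rw [Finset.sum_congr rfl this]
    simp
  have hBc : ∀ x y : ℕ → ℂ, B x y = conj (B y x) := by
    intro x y
    simp only [hB, map_sum, map_mul, Complex.conj_conj]
    rw [Finset.sum_comm]
    refine Finset.sum_congr rfl fun i _ => Finset.sum_congr rfl fun j _ => ?_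
    rw [← hherm, neg_sub]; ring
  have key : (z * conj z) * B Q.coeff Q.coeff = B (X * Q).coeff (X * Q).coeff
      - B (X*Q).coeff P.coeff - B P.coeff (X*Q).coeff + B P.coeff P.coeff := by
    simp only [hB, Finset.mul_sum, ← Finset.sum_sub_distrib, ← Finset.sum_add_distrib]
    refine Finset.sum_congr rfl fun i _ => Finset.sum_congr rfl fun j _ => ?_
    have hc : ∀ k, z * Q.coeff k = (X * Q).coeff k - P.coeff k := by
      intro k
      rw [hQ, sub_mul, coeff_sub, coeff_C_mul]; ring
    have h1 := hc j
    have h2 := congrArg conj (hc i)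
    rw [map_mul, map_sub] at h2
    linear_combination (conj z * conj (Q.coeff i) * M ((i:ℤ)-j)) * h1 + M ((i:ℤ)-j) * ((X * Q).coeff j - P.coeff j) * h2
  have hsw : B P.coeff (X * Q).coeff = conj (B (X * Q).coeff P.coeff) := hBc _ _
  rw [hsh, hsw, hBp, hBp, coeff_X_mul_zero, h0, Complex.mul_conj,
    Complex.normSq_eq_norm_sq] at key
  have key' := congrArg Complex.re key
  rw [Complex.re_ofReal_mul] at key'
  simp at key'
  have := psd Q.coeff
  change 0 ≤ (B Q.coeff Q.coeff).re at this
  have hz2 : ‖z‖^2 ≤ 1 := pow_le_one₀ (norm_nonneg _) hz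
  nlinarith

lemma aux_uniq_s12 (n : ℕ) (d : ℤ → ℂ) (hherm : ∀ l : ℤ, d (-l) = conj (d l))
    (P : ℂ[X]) (hdeg : P.natDegree ≤ n) (h0 : P.coeff 0 = 1)
    (hs : ∀ z : ℂ, ‖z‖ ≤ 1 → P.eval z ≠ 0)
    (h : ∀ k ∈ Finset.range (n+1), ∑ j ∈ Finset.range (n+1), d ((k:ℤ) - j) * P.coeff j = 0)
    (l : ℤ) (hl : |l| ≤ n) : d l = 0 := by
  set L : ℂ[X] →ₗ[ℂ] ℂ := Polynomial.lsum (fun j => LinearMap.mulRight ℂ (d ((n:ℤ) - j))) with hL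
  have hLm : ∀ j a, L (monomial j a) = a * d ((n:ℤ) - j) := by
    intro j a
    simp [hL, Polynomial.lsum]
  set R : ℂ[X] := ∑ i ∈ Finset.range (n+1), monomial (n - i) (conj (P.coeff i)) with hR
  have hRdeg : R.natDegree ≤ n := by
    refine natDegree_sum_le_of_forall_le _ _ fun i _ => ?_
    exact (natDegree_monomial_le _).trans (Nat.sub_le _ _)
  have hRmon : R.Monic := by
    refine monic_of_natDegree_le_of_coeff_eq_one n hRdeg ?_
    rw [hR, finsetSum_coeff, Finset.sum_eq_single 0]
    · simp [h0]
    · intro i hi hi0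
      rw [coeff_monomial, if_neg]
      simp at hi; omega
    · simp
  have hRn : R.natDegree = n := by
    refine le_antisymm hRdeg (le_natDegree_of_ne_zero ?_)
    have := hRmon
    rw [hR, finsetSum_coeff, Finset.sum_eq_single 0]
    · simp [h0]
    · intro i hi hi0
      rw [coeff_monomial, if_neg]
      simp at hi; omega
    · simp
  have hPs := P.as_sum_range' (n+1) (by omega)
  have hLP : ∀ j ∈ Finset.range (n+1), ∀ a, L (monomial j a * P) = 0 := by
    intro j hj a
    rw [hPs]
    simp only [Finset.mul_sum, monomial_mul_monomial, map_sum, hLm]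
    have hj' : j ≤ n := by simp at hj; omega
    have := h (n - j) (by simp)
    rw [← mul_zero a, ← this, Finset.mul_sum]
    refine Finset.sum_congr rfl fun i _ => ?_
    rw [Nat.cast_sub hj']
    push_cast
    rw [sub_sub]; ring
  have hLR : ∀ j ∈ Finset.range (n+1), ∀ a, L (monomial j a * R) = 0 := by
    intro j hj a
    rw [hR]
    simp only [Finset.mul_sum, monomial_mul_monomial, map_sum, hLm]
    have := congrArg conj (h j hj)
    rw [map_zero, map_sum] at this
    rw [← mul_zero a, ← this, Finset.mul_sum]
    refine Finset.sum_congr rfl fun i hi => ?_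
    have hi' : i ≤ n := by simp at hi; omega
    rw [map_mul, ← hherm]
    push_cast [Nat.cast_sub hi']
    rw [show (n:ℤ) - (j + (n - i)) = -(j - i) by ring]; ring
  have hsumP : ∀ (A T : ℂ[X]), (∀ j ∈ Finset.range (n+1), ∀ a, L (monomial j a * T) = 0) →
      A.natDegree ≤ n → L (A * T) = 0 := by
    intro A T hT hA
    rw [A.as_sum_range' (n+1) (by omega), Finset.sum_mul, map_sum]
    exact Finset.sum_eq_zero fun j hj => hT j hj _
  have hcop : IsCoprime P R := by
    rw [Polynomial.isCoprime_iff_aeval_ne_zero_of_isAlgClosed ℂ ℂ]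
    intro z
    simp only [coe_aeval_eq_eval]
    by_contra! hcon
    obtain ⟨hzP, hzR⟩ := hcon
    have hz1 : 1 < ‖z‖ := by
      by_contra! hle
      exact hs z hle hzP
    have hz0 : z ≠ 0 := by
      rintro rfl; simp at hz1; linarith
    have : R.eval z = z ^ n * conj (P.eval (conj z⁻¹)) := by
      rw [eval_eq_sum_range' (show P.natDegree < n+1 by omega), hR, eval_finsetSum, map_sum,
        Finset.mul_sum]
      refine Finset.sum_congr rfl fun i hi => ?_
      have hi' : i ≤ n := by simp at hi; omega
      rw [eval_monomial, map_mul, map_pow, Complex.conj_conj, pow_sub₀ _ hz0 hi', inv_pow]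
      ring
    rw [this] at hzR
    rcases mul_eq_zero.mp hzR with h1 | h1
    · exact pow_ne_zero n hz0 h1
    · refine hs (conj z⁻¹) ?_ ((map_eq_zero _).mp h1)
      rw [RCLike.norm_conj, norm_inv]
      exact inv_le_one_of_one_le₀ hz1.le
  obtain ⟨u, v, huv⟩ := hcop
  have hl' := abs_le.mp hl
  obtain ⟨j, hj⟩ : ∃ j : ℕ, (j:ℤ) = n - l := ⟨((n:ℤ) - l).toNat, by omega⟩
  set f : ℂ[X] := monomial j 1 with hf
  have hLf : L f = d l := by
    rw [hf, hLm, hj, one_mul]; congr 1; ring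
  set A := (f * u) %ₘ R with hA
  set B := f * v + P * ((f * u) /ₘ R) with hB
  have hAB : A * P + B * R = f := by
    have h1 := modByMonic_add_div (f * u) R
    rw [← hA] at h1
    rw [hB]
    linear_combination f * huv + P * h1
  have hAdeg : A.natDegree ≤ n := (natDegree_modByMonic_le _ hRmon).trans hRdeg
  have hBdeg : B.natDegree ≤ n := by
    by_cases hB0 : B = 0
    · rw [hB0]; simp
    have h2 : (R * B).natDegree = n + B.natDegree := by rw [hRmon.natDegree_mul' hB0, hRn]
    have h3 : R * B = f - A * P := by linear_combination hAB
    have h4 : (f - A * P).natDegree ≤ 2 * n := by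
      refine (natDegree_sub_le _ _).trans (max_le ?_ ?_)
      · refine (natDegree_monomial_le _).trans ?_
        omega
      · refine natDegree_mul_le.trans ?_
        omega
    rw [← h3, h2] at h4
    omega
  rw [← hLf, ← hAB, map_add, hsumP A P hLP hAdeg, hsumP B R hLR hBdeg, add_zero]

lemma aux_c (n : ℕ) (ρ : ℝ) (P : ℂ[X]) (hdeg : P.natDegree ≤ n) (h0 : P.coeff 0 = 1)
    (hs : ∀ z : ℂ, ‖z‖ ≤ 1 → P.eval z ≠ 0) (c : ℤ → ℂ)
    (hc : ∀ l, c l = (1 / (2 * Real.pi) : ℂ) *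
        ∫ w in (0 : ℝ)..(2 * Real.pi),
          ((ρ / ‖P.eval (Complex.exp (Complex.I * w))‖ ^ 2 : ℝ) : ℂ) *
            Complex.exp (-Complex.I * (l : ℂ) * (w : ℂ))) :
    (∀ l, c (-l) = conj (c l)) ∧
    ∀ k ∈ Finset.range (n+1), ∑ j ∈ Finset.range (n+1), c ((k:ℤ) - j) * P.coeff j
      = if k = 0 then (ρ : ℂ) else 0 := by
  have hn : ∀ w : ℝ, P.eval (Complex.exp (Complex.I * w)) ≠ 0 := fun w => hs _ (by
    rw [mul_comm, Complex.norm_exp_ofReal_mul_I])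
  have hconj : ∀ g : ℝ → ℂ, ∫ w in (0 : ℝ)..(2 * Real.pi), conj (g w)
      = conj (∫ w in (0 : ℝ)..(2 * Real.pi), g w) := by
    intro g
    rw [intervalIntegral.integral_of_le (by positivity), intervalIntegral.integral_of_le (by positivity),
      integral_conj]
  have hpi : conj (1 / (2 * Real.pi) : ℂ) = (1 / (2 * Real.pi) : ℂ) := by
    rw [show (1 / (2 * Real.pi) : ℂ) = ((1 / (2 * Real.pi) : ℝ) : ℂ) by push_cast; rfl,
      Complex.conj_ofReal]
  constructor
  · intro l
    rw [hc, hc, map_mul, hpi, ← hconj]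
    congr 2
    ext w
    rw [map_mul, Complex.conj_ofReal, ← Complex.exp_conj]
    simp [Complex.conj_ofReal]
  · intro k hk
    have havg : (1 / (2 * Real.pi) : ℂ) * ∫ w in (0 : ℝ)..(2 * Real.pi),
        Complex.exp (Complex.I * w) ^ k / P.eval (Complex.exp (Complex.I * w)) = if k = 0 then 1 else 0 := by
      have hd : DiffContOnCl ℂ (fun z : ℂ => z ^ k / P.eval z) (Metric.ball 0 |1|) := by
        have : DifferentiableOn ℂ (fun z : ℂ => z ^ k / P.eval z) (closure (Metric.ball 0 |1|)) := by
          rw [abs_one, closure_ball _ one_ne_zero]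
          intro z hz
          refine DifferentiableAt.differentiableWithinAt ?_
          exact (differentiableAt_id.pow k).div P.differentiableAt (hs z (by simpa using hz))
        exact this.diffContOnCl
      have := hd.circleAverage
      rw [Real.circleAverage_def] at this
      simp only [circleMap, Complex.ofReal_one, one_mul, zero_add, ← coeff_zero_eq_eval_zero, h0,
        div_one, Complex.real_smul] at this
      rw [zero_pow_eq] at this
      rw [← this]
      simp only [mul_comm Complex.I]
      push_cast
      rw [one_div]
    have hterm : ∀ j ∈ Finset.range (n+1), c ((k:ℤ) - j) * P.coeff j = (1 / (2 * Real.pi) : ℂ) *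
        ∫ w in (0 : ℝ)..(2 * Real.pi),
          ((ρ / ‖P.eval (Complex.exp (Complex.I * w))‖ ^ 2 : ℝ) : ℂ) *
            Complex.exp (-Complex.I * (((k:ℤ) - j : ℤ) : ℂ) * (w : ℂ)) * P.coeff j := by
      intro j _
      rw [hc, intervalIntegral.integral_mul_const, mul_assoc]
    rw [Finset.sum_congr rfl hterm, ← Finset.mul_sum, ← intervalIntegral.integral_finsetSum]
    swap
    · intro j _
      apply Continuous.intervalIntegrable
      have hcont : Continuous fun w : ℝ => (ρ / ‖P.eval (Complex.exp (Complex.I * w))‖ ^ 2 : ℝ) := by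
        refine continuous_const.div ?_ fun w => by simpa using hn w
        exact (continuous_norm.comp (P.continuous.comp (by fun_prop))).pow 2
      have := Complex.continuous_ofReal.comp hcont
      exact (this.mul (by fun_prop)).mul continuous_const
    have heq : ∀ w : ℝ, ∑ j ∈ Finset.range (n+1),
          ((ρ / ‖P.eval (Complex.exp (Complex.I * w))‖ ^ 2 : ℝ) : ℂ) *
            Complex.exp (-Complex.I * (((k:ℤ) - j : ℤ) : ℂ) * (w : ℂ)) * P.coeff j
        = conj (Complex.exp (Complex.I * w) ^ k / P.eval (Complex.exp (Complex.I * w))) * ρ := by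
      intro w
      have h1 : ∀ j ∈ Finset.range (n+1), ((ρ / ‖P.eval (Complex.exp (Complex.I * w))‖ ^ 2 : ℝ) : ℂ) *
            Complex.exp (-Complex.I * (((k:ℤ) - j : ℤ) : ℂ) * (w : ℂ)) * P.coeff j =
          ((ρ / ‖P.eval (Complex.exp (Complex.I * w))‖ ^ 2 : ℝ) : ℂ) * conj (Complex.exp (Complex.I * w) ^ k)
            * (P.coeff j * Complex.exp (Complex.I * w) ^ j) := by
        intro j _
        rw [← Complex.exp_nat_mul, ← Complex.exp_nat_mul, ← Complex.exp_conj]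
        have : Complex.exp (-Complex.I * (((k:ℤ) - j : ℤ) : ℂ) * (w : ℂ)) =
            Complex.exp (conj ((k:ℂ) * (Complex.I * w))) * Complex.exp (j * (Complex.I * w)) := by
          rw [← Complex.exp_add]
          congr 1
          simp [Complex.conj_ofReal]
          ring
        rw [this]; ring
      rw [Finset.sum_congr rfl h1, ← Finset.mul_sum, ← eval_eq_sum_range' (show P.natDegree < n+1 by omega)]
      have h2 := hn w
      set q := P.eval (Complex.exp (Complex.I * w))
      have h3 : conj q ≠ 0 := (_root_.map_ne_zero _).mpr h2
      push_cast
      rw [← Complex.mul_conj', map_div₀]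
      field_simp
    simp only [heq]
    rw [intervalIntegral.integral_mul_const, hconj, ← mul_assoc, ← hpi, ← map_mul, havg]
    split_ifs <;> simp

theorem stmt12 (N : ℕ) (hN : 0 < N) (M : ℤ → ℂ)
    (hherm : ∀ l : ℤ, M (-l) = star (M l))
    (hpos : (Matrix.of fun k l : Fin N => M ((k : ℤ) - (l : ℤ))).PosDef)
    (p : Fin N → ℂ) (ρ : ℝ) (hρ : 0 < ρ)
    (hp : (Matrix.of fun k l : Fin N => M ((k : ℤ) - (l : ℤ))).mulVec p =
      (ρ : ℂ) • (Pi.single ⟨0, hN⟩ 1 : Fin N → ℂ))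
    (hp0 : p ⟨0, hN⟩ = 1) :
    ∀ l : ℤ, |l| ≤ (N : ℤ) - 1 →
      (1 / (2 * Real.pi) : ℂ) *
        ∫ w in (0 : ℝ)..(2 * Real.pi),
          ((ρ / ‖∑ k : Fin N, p k * Complex.exp (Complex.I * (w : ℂ) * (k : ℂ))‖ ^ 2 : ℝ) : ℂ) *
            Complex.exp (-Complex.I * (l : ℂ) * (w : ℂ)) = M l := by
  obtain ⟨n, rfl⟩ : ∃ n, N = n + 1 := ⟨N - 1, by omega⟩
  intro l hl
  set P : ℂ[X] := ∑ k : Fin (n+1), monomial (k:ℕ) (p k) with hP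
  have hcoeff : ∀ k : Fin (n+1), P.coeff k = p k := by
    intro k
    rw [hP, finsetSum_coeff, Finset.sum_eq_single k]
    · simp
    · intro b _ hb
      rw [coeff_monomial, if_neg]
      exact fun h => hb (Fin.ext h)
    · simp
  have hdeg : P.natDegree ≤ n := by
    refine natDegree_sum_le_of_forall_le _ _ fun i _ => ?_
    exact (natDegree_monomial_le _).trans (by omega)
  have h0 : P.coeff 0 = 1 := by
    rw [← hp0, ← hcoeff]
  have hM : ∀ k ∈ Finset.range (n+1), ∑ j ∈ Finset.range (n+1), M ((k:ℤ) - j) * P.coeff j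
      = if k = 0 then (ρ : ℂ) else 0 := by
    intro k hk
    have := congrFun hp ⟨k, by simpa using hk⟩
    simp only [Matrix.mulVec, dotProduct, Matrix.of_apply, Pi.smul_apply, Pi.single_apply] at this
    rw [Finset.sum_range]
    simp only [hcoeff]
    rw [this]
    simp [Fin.ext_iff]
  have hpsd : ∀ x : ℕ → ℂ, 0 ≤ (∑ i ∈ Finset.range (n+1), ∑ j ∈ Finset.range (n+1),
      conj (x i) * M ((i:ℤ) - j) * x j).re := by
    intro x
    have := hpos.posSemidef.re_dotProduct_nonneg (fun i : Fin (n+1) => x i)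
    simp only [Matrix.mulVec, dotProduct, Matrix.of_apply, Finset.mul_sum] at this
    simp only [Finset.sum_range]
    convert this using 1
    simp [mul_assoc]
  have hs := aux_stable n M ρ hρ hherm hpsd P hdeg hM h0
  obtain ⟨hc1, hc2⟩ := aux_c n ρ P hdeg h0 hs _ (fun l => rfl)
  have heval : ∀ w : ℝ, P.eval (Complex.exp (Complex.I * w)) =
      ∑ k : Fin (n+1), p k * Complex.exp (Complex.I * (w : ℂ) * (k : ℂ)) := by
    intro w
    rw [hP, eval_finsetSum]
    refine Finset.sum_congr rfl fun k _ => ?_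
    rw [eval_monomial, ← Complex.exp_nat_mul, mul_comm (k:ℂ)]
  simp only [← heval]
  set c : ℤ → ℂ := fun l => (1 / (2 * Real.pi) : ℂ) *
        ∫ w in (0 : ℝ)..(2 * Real.pi),
          ((ρ / ‖P.eval (Complex.exp (Complex.I * w))‖ ^ 2 : ℝ) : ℂ) *
            Complex.exp (-Complex.I * (l : ℂ) * (w : ℂ)) with hcdef
  change c l = M l
  have := aux_uniq_s12 n (fun l => c l - M l) (fun l => by
      have h1 : c (-l) = conj (c l) := hc1 l
      have h2 : M (-l) = conj (M l) := hherm l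
      simp only [h1, h2, map_sub]) P hdeg h0 hs (fun k hk => by
      simp only [sub_mul, Finset.sum_sub_distrib]
      rw [hM k hk, sub_eq_zero]
      exact hc2 k hk) l (by push_cast at hl; linarith)
  exact sub_eq_zero.mp this
end
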